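/- arXiv:2302.07812 — 3 statements merged into one kernel-verified Lean document; each statement's English description precedes it below -/
import Mathlib

section
/- Let A and B be commutative unital Banach algebras and let T : A → B be a continuous algebra homomorphism with dense range. If A satisfies strong Ditkin's condition (i.e., A is a strong Ditkin algebra), then B satisfies strong Ditkin's condition. -/
open WeakDual Topology

namespace VV

variable (B : Type*) [NormedCommRing B] [NormedAlgebra ℂ B]

/-- The ideal `I_ψ = {b | ψ b = 0}`. -/
def Iid (ψ : characterSpace ℂ B) : Set B := {b : B | ψ b = 0}

/-- The ideal `J_ψ` of elements whose Gelfand transform vanishes on a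
neighbourhood of `ψ`. -/
def Jid (ψ : characterSpace ℂ B) : Set B :=
  {b : B | ∃ U ∈ nhds ψ, ∀ χ ∈ U, χ b = 0}

/-- Regularity of a commutative Banach algebra. -/
def IsRegular : Prop :=
  ∀ E : Set (characterSpace ℂ B), IsClosed E →
    ∀ ψ₀ ∉ E, ∃ b : B, ψ₀ b ≠ 0 ∧ ∀ ψ ∈ E, ψ b = 0

def IsStronglyRegularAt (ψ : characterSpace ℂ B) : Prop :=
  Iid B ψ ⊆ closure (Jid B ψ)

def IsStronglyRegular : Prop := ∀ ψ : characterSpace ℂ B, IsStronglyRegularAt B ψ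

/-- Bounded relative units at a character. -/
def HasBRUAt (ψ : characterSpace ℂ B) : Prop :=
  ∃ M : ℝ, 0 < M ∧ ∀ K : Set (characterSpace ℂ B), IsCompact K → ψ ∉ K →
    ∃ b ∈ Jid B ψ, (∀ χ ∈ K, χ b = 1) ∧ ‖b‖ ≤ M

def HasBRU : Prop := ∀ ψ : characterSpace ℂ B, HasBRUAt B ψ

/-- Ditkin's condition at a character: `b ∈ closure (b • J_ψ)` for every `b ∈ I_ψ`. -/
def DitkinAt (ψ : characterSpace ℂ B) : Prop :=
  ∀ b ∈ Iid B ψ, b ∈ closure ((fun u => b * u) '' Jid B ψ)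

def IsDitkin : Prop := ∀ ψ : characterSpace ℂ B, DitkinAt B ψ

/-- `I` has a bounded approximate identity contained in `J`: a bounded net `(u_i)`
in `J` with `‖b * u_i - b‖ → 0` for every `b ∈ I`. -/
def HasBAI (I J : Set B) : Prop :=
  ∃ (ι : Type) (le : ι → ι → Prop) (u : ι → B) (M : ℝ),
    Nonempty ι ∧ (∀ i j : ι, ∃ k, le i k ∧ le j k) ∧
    (∀ i, u i ∈ J) ∧ (∀ i, ‖u i‖ ≤ M) ∧
    ∀ b ∈ I, ∀ ε : ℝ, 0 < ε → ∃ i, ∀ j, le i j → ‖b * u j - b‖ < ε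

/-- Strong Ditkin's condition at `ψ`. -/
def StrongDitkinAt (ψ : characterSpace ℂ B) : Prop := HasBAI B (Iid B ψ) (Jid B ψ)

def IsStrongDitkin : Prop := ∀ ψ : characterSpace ℂ B, StrongDitkinAt B ψ

/-- Normality. -/
def IsNormal : Prop :=
  ∀ E : Set (characterSpace ℂ B), IsClosed E → E ≠ Set.univ →
    ∀ F : Set (characterSpace ℂ B), IsCompact F → (∀ ψ ∈ F, ψ ∉ E) →
      ∃ b : B, (∀ ψ ∈ F, ψ b = 1) ∧ ∀ ψ ∈ E, ψ b = 0

/-- Semisimplicity: the Gelfand transform is injective. -/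
def IsSemisimple : Prop :=
  ∀ b : B, (∀ ψ : characterSpace ℂ B, ψ b = 0) → b = 0

end VV

namespace VV

variable {A : Type*} [NormedCommRing A] [NormedAlgebra ℂ A]
variable {B : Type*} [NormedCommRing B] [NormedAlgebra ℂ B]

/-- The character `ψ ∘ T` obtained by pulling back `ψ` along a continuous homomorphism `T`. -/
noncomputable def pullback (T : A →ₐ[ℂ] B) (hT : Continuous T) (ψ : characterSpace ℂ B) :
    characterSpace ℂ A :=
  ⟨StrongDual.toWeakDual ((CharacterSpace.toCLM ψ).comp ⟨T.toLinearMap, hT⟩), by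
    rw [CharacterSpace.eq_set_map_one_map_mul]
    refine ⟨?_, fun x y => ?_⟩
    · change ψ (T 1) = 1
      rw [map_one, map_one]
    · change ψ (T (x * y)) = ψ (T x) * ψ (T y)
      rw [map_mul, map_mul]⟩

@[simp]
theorem pullback_apply (T : A →ₐ[ℂ] B) (hT : Continuous T) (ψ : characterSpace ℂ B) (a : A) :
    pullback T hT ψ a = ψ (T a) := rfl

theorem continuous_pullback (T : A →ₐ[ℂ] B) (hT : Continuous T) :
    Continuous (pullback T hT) :=
  Continuous.subtype_mk (WeakDual.continuous_of_continuous_eval fun a =>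
    (WeakDual.eval_continuous (T a)).comp continuous_subtype_val) _

theorem map_mem_Jid (T : A →ₐ[ℂ] B) (hT : Continuous T) (ψ : characterSpace ℂ B) {a : A}
    (ha : a ∈ Jid A (pullback T hT ψ)) : T a ∈ Jid B ψ := by
  obtain ⟨U, hU, hUa⟩ := ha
  exact ⟨pullback T hT ⁻¹' U, (continuous_pullback T hT).continuousAt.preimage_mem_nhds hU,
    fun χ hχ => hUa _ hχ⟩

theorem mem_closure_image_Iid (T : A →ₐ[ℂ] B) (hT : Continuous T) (hd : DenseRange T)
    (ψ : characterSpace ℂ B) {b : B} (hb : b ∈ Iid B ψ) :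
    b ∈ closure (T '' Iid A (pullback T hT ψ)) := by
  have hcont : Continuous fun c : B => c - ψ c • (1 : B) :=
    continuous_id.sub ((map_continuous ψ).smul continuous_const)
  have hmaps : Set.MapsTo (fun c : B => c - ψ c • (1 : B)) (Set.range T)
      (T '' Iid A (pullback T hT ψ)) := by
    rintro _ ⟨a, rfl⟩
    refine ⟨a - ψ (T a) • 1, ?_, by simp⟩
    change ψ (T (a - ψ (T a) • 1)) = 0
    simp
  have hψ : ψ b = 0 := hb
  simpa [hψ] using hmaps.closure hcont (hd b)

theorem StrongDitkinAt.of_denseRange_hom (T : A →ₐ[ℂ] B) (hT : Continuous T) (hd : DenseRange T)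
    (ψ : characterSpace ℂ B) (h : StrongDitkinAt A (pullback T hT ψ)) : StrongDitkinAt B ψ := by
  obtain ⟨ι, le, u, M, hne, hdir, huJ, huM, hu⟩ := h
  let L : A →L[ℂ] B := ⟨T.toLinearMap, hT⟩
  have hL : ∀ a, ‖T a‖ ≤ ‖L‖ * ‖a‖ := L.le_opNorm
  have hTM : ∀ i, ‖T (u i)‖ ≤ ‖L‖ * M := fun i => (hL _).trans (by gcongr; exact huM i)
  have hM : 0 ≤ ‖L‖ * M := (norm_nonneg _).trans (hTM hne.some)
  refine ⟨ι, le, fun i => T (u i), ‖L‖ * M, hne, hdir, fun i => map_mem_Jid T hT ψ (huJ i),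
    hTM, fun b hb ε hε => ?_⟩
  obtain ⟨_, ⟨a, ha, rfl⟩, hab⟩ := Metric.mem_closure_iff.1 (mem_closure_image_Iid T hT hd ψ hb)
    (ε / (2 * (‖L‖ * M + 1))) (by positivity)
  obtain ⟨i, hi⟩ := hu a ha (ε / (2 * (‖L‖ + 1))) (by positivity)
  refine ⟨i, fun j hj => ?_⟩
  rw [dist_eq_norm, lt_div_iff₀ (by positivity)] at hab
  have haj := hi j hj
  rw [lt_div_iff₀ (by positivity)] at haj
  have hsplit : b * T (u j) - b = (b - T a) * T (u j) + T (a * u j - a) - (b - T a) := by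
    rw [map_sub, map_mul]
    ring
  calc ‖b * T (u j) - b‖
      ≤ ‖(b - T a) * T (u j)‖ + ‖T (a * u j - a)‖ + ‖b - T a‖ := by
        rw [hsplit]
        exact (norm_sub_le _ _).trans (by gcongr; exact norm_add_le _ _)
    _ ≤ ‖b - T a‖ * (‖L‖ * M) + ‖L‖ * ‖a * u j - a‖ + ‖b - T a‖ := by
        gcongr
        · exact (norm_mul_le _ _).trans (by gcongr; exact hTM j)
        · exact hL _
    _ < ε := by nlinarith [norm_nonneg (a * u j - a)]

end VV

theorem strongDitkin_of_denseRange_hom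
    (A : Type*) [NormedCommRing A] [NormedAlgebra ℂ A] [CompleteSpace A] [Nontrivial A]
    (B : Type*) [NormedCommRing B] [NormedAlgebra ℂ B] [CompleteSpace B] [Nontrivial B]
    (T : A →ₐ[ℂ] B) (hTcont : Continuous T) (hTdense : DenseRange T)
    (hA : VV.IsStrongDitkin A) : VV.IsStrongDitkin B := fun ψ =>
  VV.StrongDitkinAt.of_denseRange_hom T hTcont hTdense ψ (hA _)
end

section
/- Let X be a compact Hausdorff space, A a semisimple commutative unital Banach algebra, and 𝑨 an admissible Banach A-valued function algebra on X with 𝔄 = 𝑨 ∩ C(X), such that every character of 𝑨 is of the form ψ⋄φ with ψ ∈ Φ(𝔄), φ ∈ Φ(A). Suppose the subalgebra 𝔄A generated by 𝔄 ∪ A (consisting of all functions f = Σ_{i=1}^n f_i a_i with f_i ∈ 𝔄, a_i ∈ A) is dense in 𝑨. If 𝔄 and A are strongly regular, then 𝑨 is strongly regular. -/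
open WeakDual Topology

namespace VV

variable (B : Type*) [NormedCommRing B] [NormedAlgebra ℂ B]

variable (X : Type*) [TopologicalSpace X] [CompactSpace X] [T2Space X]
variable (A : Type*) [NormedCommRing A] [NormedAlgebra ℂ A] [CompleteSpace A] [Nontrivial A]

section FunctionAlgebra

variable (B : Type*) [NormedCommRing B] [NormedAlgebra ℂ B] [CompleteSpace B] [Nontrivial B]

/-- `𝑨` contains the constant functions. -/
def ContainsConstants (ι : B →ₐ[ℂ] C(X, A)) : Prop :=
  ∀ a : A, ∃ b : B, ∀ x : X, ι b x = a

/-- `𝑨` separates the points of `X`. -/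
def Separates (ι : B →ₐ[ℂ] C(X, A)) : Prop :=
  ∀ x y : X, x ≠ y → ∃ b : B, ι b x ≠ ι b y

/-- Admissibility: `φ ∘ f ∈ 𝑨` whenever `f ∈ 𝑨` and `φ ∈ Φ(A)`. -/
def Admissible (ι : B →ₐ[ℂ] C(X, A)) : Prop :=
  ∀ (f : B) (φ : characterSpace ℂ A), ∃ g : B,
    ∀ x : X, ι g x = algebraMap ℂ A (φ (ι f x))

/-- The subalgebra `𝔄 = 𝑨 ∩ C(X)` of scalar-valued members of `𝑨`. -/
def scalarSub (ι : B →ₐ[ℂ] C(X, A)) : Subalgebra ℂ B where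
  carrier := {b : B | ∀ x : X, ∃ c : ℂ, ι b x = algebraMap ℂ A c}
  mul_mem' := by
    intro b b' hb hb' x
    obtain ⟨c, hc⟩ := hb x
    obtain ⟨c', hc'⟩ := hb' x
    refine ⟨c * c', ?_⟩
    rw [map_mul, ContinuousMap.mul_apply, hc, hc', map_mul]
  add_mem' := by
    intro b b' hb hb' x
    obtain ⟨c, hc⟩ := hb x
    obtain ⟨c', hc'⟩ := hb' x
    refine ⟨c + c', ?_⟩
    rw [map_add, ContinuousMap.add_apply, hc, hc', map_add]
  algebraMap_mem' := by
    intro r x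
    refine ⟨r, ?_⟩
    rw [AlgHom.commutes]
    simp [Algebra.algebraMap_eq_smul_one]

/-- `𝑨` is an `A`-valued uniform algebra: its norm is equivalent to the sup norm. -/
def IsUniform (ι : B →ₐ[ℂ] C(X, A)) : Prop :=
  ∃ c C : ℝ, 0 < c ∧ ∀ b : B, c * ‖ι b‖ ≤ ‖b‖ ∧ ‖b‖ ≤ C * ‖ι b‖

/-- Every character of `𝑨` is of the form `ψ ⋄ φ`. -/
def NaturalProduct (ι : B →ₐ[ℂ] C(X, A)) : Prop :=
  ∀ τ : characterSpace ℂ B,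
    ∃ (ψ : characterSpace ℂ (scalarSub X A B ι)) (φ : characterSpace ℂ A),
      ∀ (f : B) (g : scalarSub X A B ι),
        (∀ x : X, ι (g : B) x = algebraMap ℂ A (φ (ι f x))) → τ f = ψ g

end FunctionAlgebra

end VV

namespace VV

section Characters

variable {B : Type*} [NormedCommRing B] [NormedAlgebra ℂ B]
variable {C : Type*} [NormedCommRing C] [NormedAlgebra ℂ C]

/-- The pullback of a character along a continuous algebra homomorphism. -/
noncomputable def compChar (h : C →ₐ[ℂ] B) (hc : Continuous h) (τ : characterSpace ℂ B) :
    characterSpace ℂ C :=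
  ⟨(CharacterSpace.toCLM τ).comp ⟨h.toLinearMap, hc⟩, by
    rw [CharacterSpace.eq_set_map_one_map_mul]
    exact ⟨(congrArg τ (map_one h)).trans (map_one τ),
      fun x y => (congrArg τ (map_mul h x y)).trans (map_mul τ _ _)⟩⟩

@[simp]
theorem compChar_apply (h : C →ₐ[ℂ] B) (hc : Continuous h) (τ : characterSpace ℂ B) (c : C) :
    compChar h hc τ c = τ (h c) :=
  rfl

theorem continuous_compChar (h : C →ₐ[ℂ] B) (hc : Continuous h) :
    Continuous (compChar h hc) :=
  Continuous.subtype_mk (continuous_of_continuous_eval fun c =>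
    (WeakDual.eval_continuous (h c)).comp continuous_subtype_val) _

/-- `J_τ` as an ideal. -/
def idealJ (τ : characterSpace ℂ B) : Ideal B where
  carrier := Jid B τ
  zero_mem' := ⟨Set.univ, Filter.univ_mem, fun χ _ => map_zero χ⟩
  add_mem' := by
    rintro a b ⟨U, hU, ha⟩ ⟨V, hV, hb⟩
    exact ⟨U ∩ V, Filter.inter_mem hU hV, fun χ hχ => by
      rw [map_add, ha χ hχ.1, hb χ hχ.2, add_zero]⟩
  smul_mem' := by
    rintro c a ⟨U, hU, ha⟩
    exact ⟨U, hU, fun χ hχ => by rw [smul_eq_mul, map_mul, ha χ hχ, mul_zero]⟩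

/-- The elements `f` for which `f - τ(f)` lies in the closure of `J_τ`. -/
def approxSubalgebra (τ : characterSpace ℂ B) : Subalgebra ℂ B where
  carrier := {f | f - algebraMap ℂ B (τ f) ∈ (idealJ τ).closure}
  mul_mem' := by
    intro f g hf hg
    have e : f * g - algebraMap ℂ B (τ (f * g)) = (f - algebraMap ℂ B (τ f)) * g +
        algebraMap ℂ B (τ f) * (g - algebraMap ℂ B (τ g)) := by
      rw [map_mul, map_mul]; ring
    rw [Set.mem_ofPred_eq, e]
    exact Ideal.add_mem _ (Ideal.mul_mem_right g _ hf)
      (Ideal.mul_mem_left _ (algebraMap ℂ B (τ f)) hg)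
  add_mem' := by
    intro f g hf hg
    have e : f + g - algebraMap ℂ B (τ (f + g)) = (f - algebraMap ℂ B (τ f)) +
        (g - algebraMap ℂ B (τ g)) := by
      rw [map_add, map_add]; ring
    rw [Set.mem_ofPred_eq, e]
    exact Ideal.add_mem _ hf hg
  algebraMap_mem' := by
    intro r
    have e : algebraMap ℂ B r - algebraMap ℂ B (τ (algebraMap ℂ B r)) = 0 := by
      rw [AlgHomClass.commutes τ r, Algebra.algebraMap_self_apply, sub_self]
    rw [Set.mem_ofPred_eq, e]
    exact Ideal.zero_mem _

theorem isClosed_approxSubalgebra (τ : characterSpace ℂ B) :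
    IsClosed (approxSubalgebra τ : Set B) := by
  have hcont : Continuous fun f : B => f - algebraMap ℂ B (τ f) :=
    continuous_id.sub ((continuous_algebraMap ℂ B).comp (map_continuous τ))
  exact (isClosed_closure (s := Jid B τ)).preimage hcont

theorem isStronglyRegularAt_of_dense {τ : characterSpace ℂ B}
    (h : Dense (approxSubalgebra τ : Set B)) : IsStronglyRegularAt B τ := by
  intro f hf
  have hmem : f - algebraMap ℂ B (τ f) ∈ closure (Jid B τ) :=
    (isClosed_approxSubalgebra τ).closure_subset (h f)
  rwa [show τ f = 0 from hf, map_zero, sub_zero] at hmem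

theorem map_mem_approxSubalgebra (h : C →ₐ[ℂ] B) (hc : Continuous h) (τ : characterSpace ℂ B)
    (hC : IsStronglyRegularAt C (compChar h hc τ)) (c : C) : h c ∈ approxSubalgebra τ := by
  have hI : c - algebraMap ℂ C (τ (h c)) ∈ Iid C (compChar h hc τ) := by
    change compChar h hc τ (c - algebraMap ℂ C (τ (h c))) = 0
    rw [map_sub, AlgHomClass.commutes, compChar_apply, Algebra.algebraMap_self_apply, sub_self]
  have hmaps : Set.MapsTo h (Jid C (compChar h hc τ)) (Jid B τ) := by
    rintro x ⟨U, hU, hx⟩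
    exact ⟨_, (continuous_compChar h hc).continuousAt.preimage_mem_nhds hU, fun χ hχ => hx _ hχ⟩
  have := map_mem_closure hc (hC hI) hmaps
  rw [map_sub, AlgHom.commutes] at this
  exact this

/-- Homomorphisms from a Banach algebra to a semisimple commutative Banach algebra are
continuous. -/
theorem continuous_of_isSemisimple [CompleteSpace B] [CompleteSpace C] (hB : IsSemisimple B)
    (h : C →ₐ[ℂ] B) : Continuous h := by
  refine LinearMap.continuous_of_seq_closed_graph (g := h.toLinearMap) fun u x y hu hhu => ?_
  refine sub_eq_zero.1 (hB _ fun τ => ?_)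
  rw [map_sub, sub_eq_zero]
  have hcomp : Continuous ((CharacterSpace.toAlgHom τ).comp h) := map_continuous _
  exact tendsto_nhds_unique (((map_continuous τ).tendsto y).comp hhu) ((hcomp.tendsto x).comp hu)

end Characters

section FunctionAlgebra

variable {X : Type*} [TopologicalSpace X]
variable {A : Type*} [NormedCommRing A] [NormedAlgebra ℂ A]
variable {B : Type*} [NormedCommRing B] [NormedAlgebra ℂ B]

theorem isSemisimple_of_injective [CompleteSpace B] (hA : IsSemisimple A)
    (ι : B →ₐ[ℂ] C(X, A)) (hinj : Function.Injective ι) : IsSemisimple B := by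
  intro b hb
  refine hinj (ContinuousMap.ext fun x => ?_)
  rw [map_zero]
  refine hA _ fun φ => ?_
  exact hb (CharacterSpace.equivAlgHom.symm ((CharacterSpace.toAlgHom φ).comp
    ((ContinuousMap.evalAlgHom ℂ A x).comp ι)))

theorem exists_constAlgHom (ι : B →ₐ[ℂ] C(X, A)) (hinj : Function.Injective ι)
    (hconst : ∀ a : A, ∃ b : B, ∀ x : X, ι b x = a) :
    ∃ j : A →ₐ[ℂ] B, ∀ a x, ι (j a) x = a := by
  choose j hj using hconst
  refine ⟨{ toFun := j, map_one' := ?_, map_mul' := ?_, map_zero' := ?_, map_add' := ?_,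
            commutes' := ?_ }, hj⟩ <;> intros <;> apply hinj <;> ext x <;> simp [hj, Algebra.algebraMap_eq_smul_one]

end FunctionAlgebra

end VV

theorem stronglyRegular_of_components_dense
    (X : Type*) [TopologicalSpace X] [CompactSpace X] [T2Space X]
    (A : Type*) [NormedCommRing A] [NormedAlgebra ℂ A] [CompleteSpace A] [Nontrivial A]
    (hss : VV.IsSemisimple A)
    (B : Type*) [NormedCommRing B] [NormedAlgebra ℂ B] [CompleteSpace B] [Nontrivial B]
    (ι : B →ₐ[ℂ] C(X, A)) (hinj : Function.Injective ι)
    (hconst : VV.ContainsConstants X A B ι) (hsep : VV.Separates X A B ι)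
    (hadm : VV.Admissible X A B ι) (hnat : VV.NaturalProduct X A B ι)
    (hdense : Dense {f : B | ∃ (n : ℕ) (g : Fin n → (VV.scalarSub X A B ι))
      (b : Fin n → B), (∀ i, ∃ a : A, ∀ x : X, ι (b i) x = a) ∧
        f = ∑ i, ((g i : B) * b i)})
    (hfA : VV.IsStronglyRegular (VV.scalarSub X A B ι)) (hA : VV.IsStronglyRegular A) :
    VV.IsStronglyRegular B := by
  have hBss := VV.isSemisimple_of_injective hss ι hinj
  obtain ⟨j, hj⟩ := VV.exists_constAlgHom ι hinj hconst
  have hjc := VV.continuous_of_isSemisimple hBss j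
  refine fun τ => VV.isStronglyRegularAt_of_dense (hdense.mono ?_)
  rintro f ⟨n, g, b, hb, rfl⟩
  refine sum_mem fun i _ => mul_mem ?_ ?_
  · exact VV.map_mem_approxSubalgebra (VV.scalarSub X A B ι).val continuous_subtype_val τ
      (hfA _) (g i)
  · obtain ⟨a, ha⟩ := hb i
    have hba : b i = j a := hinj (ContinuousMap.ext fun x => (ha x).trans (hj a x).symm)
    exact hba ▸ VV.map_mem_approxSubalgebra j hjc τ (hA _) a
end

section
/- Let X be a compact Hausdorff space, A a semisimple commutative unital Banach algebra, and 𝑨 an admissible A-valued uniform algebra on X with 𝔄 = 𝑨 ∩ C(X), such that every character of 𝑨 is of the form ψ⋄φ with ψ ∈ Φ(𝔄), φ ∈ Φ(A). Suppose 𝔄 admits bounded relative units. Then 𝑨 is a Ditkin algebra if and only if A is a Ditkin algebra. -/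
open WeakDual Topology

namespace VV

section Comap

variable {R S : Type*} [NormedCommRing R] [NormedAlgebra ℂ R] [NormedCommRing S]
  [NormedAlgebra ℂ S]

/-- The pullback of a character along a continuous algebra homomorphism. -/
noncomputable def comapChar (h : R →ₐ[ℂ] S) (hh : Continuous h) (χ : characterSpace ℂ S) :
    characterSpace ℂ R :=
  ⟨StrongDual.toWeakDual ((WeakDual.toStrongDual (χ : WeakDual ℂ S)).comp ⟨h.toLinearMap, hh⟩), by
    rw [WeakDual.CharacterSpace.eq_set_map_one_map_mul]
    constructor
    · change χ (h 1) = 1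
      rw [map_one, map_one]
    · intro a b
      change χ (h (a * b)) = χ (h a) * χ (h b)
      rw [map_mul, map_mul]⟩

@[simp]
theorem comapChar_apply (h : R →ₐ[ℂ] S) (hh : Continuous h) (χ : characterSpace ℂ S) (a : R) :
    comapChar h hh χ a = χ (h a) := rfl

theorem continuous_characterSpace_iff {T : Type*} [TopologicalSpace T]
    {g : T → characterSpace ℂ R} : Continuous g ↔ ∀ a : R, Continuous fun t => g t a := by
  constructor
  · intro hg a
    exact (WeakDual.eval_continuous a).comp (continuous_subtype_val.comp hg)
  · intro hg
    exact Continuous.subtype_mk (WeakDual.continuous_of_continuous_eval hg) _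

theorem continuous_comapChar (h : R →ₐ[ℂ] S) (hh : Continuous h) :
    Continuous (comapChar h hh) :=
  continuous_characterSpace_iff.2 fun a => continuous_characterSpace_iff.1 continuous_id (h a)

theorem map_mem_Jid_s16 (h : R →ₐ[ℂ] S) (hh : Continuous h) {χ : characterSpace ℂ S}
    {u : R} (hu : u ∈ Jid R (comapChar h hh χ)) : h u ∈ Jid S χ := by
  obtain ⟨U, hU, hzero⟩ := hu
  exact ⟨_, (continuous_comapChar h hh).continuousAt hU, fun χ' hχ' => hzero _ hχ'⟩

theorem add_sub_mul_mem_Jid {χ : characterSpace ℂ R} {u v : R} (hu : u ∈ Jid R χ)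
    (hv : v ∈ Jid R χ) : u + v - u * v ∈ Jid R χ := by
  obtain ⟨U, hU, hu⟩ := hu
  obtain ⟨V, hV, hv⟩ := hv
  refine ⟨U ∩ V, Filter.inter_mem hU hV, fun χ' hχ' => ?_⟩
  simp [hu χ' hχ'.1, hv χ' hχ'.2]

theorem apply_eq_zero_of_mem_Jid {χ : characterSpace ℂ R} {u : R} (hu : u ∈ Jid R χ) :
    χ u = 0 := by
  obtain ⟨U, hU, hu⟩ := hu
  exact hu χ (mem_of_mem_nhds hU)

end Comap

section FunctionAlgebra

variable {X : Type*} [TopologicalSpace X]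
  {A : Type*} [NormedCommRing A] [NormedAlgebra ℂ A]
  {B : Type*} [NormedCommRing B] [NormedAlgebra ℂ B]

/-- Evaluation at `x` as a homomorphism from a function algebra to `A`. -/
def evalHom (ι : B →ₐ[ℂ] C(X, A)) (x : X) : B →ₐ[ℂ] A :=
  (ContinuousMap.evalAlgHom ℂ A x).comp ι

@[simp]
theorem evalHom_apply (ι : B →ₐ[ℂ] C(X, A)) (x : X) (b : B) : evalHom ι x b = ι b x := rfl

theorem continuous_evalHom {ι : B →ₐ[ℂ] C(X, A)} (h : Continuous ι) (x : X) :
    Continuous (evalHom ι x) :=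
  (continuous_eval_const x).comp h

/-- The embedding of `A` as the constant functions. -/
noncomputable def constHom {ι : B →ₐ[ℂ] C(X, A)} (hinj : Function.Injective ι)
    (hconst : ContainsConstants X A B ι) : A →ₐ[ℂ] B where
  toFun a := (hconst a).choose
  map_one' := hinj (by ext x; simp [(hconst 1).choose_spec x])
  map_mul' a b := hinj (by
    ext x
    simp [(hconst (a * b)).choose_spec x, (hconst a).choose_spec x, (hconst b).choose_spec x])
  map_zero' := hinj (by ext x; simp [(hconst 0).choose_spec x])
  map_add' a b := hinj (by
    ext x
    simp [(hconst (a + b)).choose_spec x, (hconst a).choose_spec x, (hconst b).choose_spec x])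
  commutes' r := hinj (by
    ext x
    rw [(hconst _).choose_spec x, AlgHom.commutes]
    rfl)

@[simp]
theorem constHom_apply {ι : B →ₐ[ℂ] C(X, A)} (hinj : Function.Injective ι)
    (hconst : ContainsConstants X A B ι) (a : A) (x : X) : ι (constHom hinj hconst a) x = a :=
  (hconst a).choose_spec x

/-- The character of `𝔄` given by evaluation at `x`. -/
noncomputable def evalChar {ι : B →ₐ[ℂ] C(X, A)} (h : Continuous ι) (φ : characterSpace ℂ A)
    (x : X) : characterSpace ℂ (scalarSub X A B ι) :=
  comapChar ((evalHom ι x).comp (scalarSub X A B ι).val)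
    ((continuous_evalHom h x).comp continuous_subtype_val) φ

theorem evalChar_apply {ι : B →ₐ[ℂ] C(X, A)} (h : Continuous ι) (φ : characterSpace ℂ A)
    (x : X) (g : scalarSub X A B ι) : evalChar h φ x g = φ (ι (g : B) x) := rfl

theorem algebraMap_evalChar {ι : B →ₐ[ℂ] C(X, A)} (h : Continuous ι) (φ : characterSpace ℂ A)
    (x : X) (g : scalarSub X A B ι) : algebraMap ℂ A (evalChar h φ x g) = ι (g : B) x := by
  obtain ⟨c, hc⟩ := g.2 x
  rw [evalChar_apply, hc, AlgHomClass.commutes, Algebra.algebraMap_self_apply]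

theorem continuous_evalChar {ι : B →ₐ[ℂ] C(X, A)} (h : Continuous ι) (φ : characterSpace ℂ A) :
    Continuous (evalChar h φ) :=
  continuous_characterSpace_iff.2 fun g =>
    (map_continuous φ).comp (ι (g : B)).continuous

/-- Evaluations at `x` and `y` agree on `𝔄` only if they agree on the whole algebra. -/
theorem apply_eq_of_evalChar_eq (hss : IsSemisimple A) {ι : B →ₐ[ℂ] C(X, A)}
    (hadm : Admissible X A B ι) (h : Continuous ι) (φ : characterSpace ℂ A) {x y : X}
    (hxy : evalChar h φ x = evalChar h φ y) (f : B) : ι f x = ι f y := by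
  rw [← sub_eq_zero]
  refine hss _ fun φ' => ?_
  obtain ⟨g, hg⟩ := hadm f φ'
  have key := DFunLike.congr_fun hxy (⟨g, fun z => ⟨_, hg z⟩⟩ : scalarSub X A B ι)
  simp only [evalChar_apply, hg, AlgHomClass.commutes, Algebra.algebraMap_self_apply] at key
  rw [map_sub, key, sub_self]

theorem IsDitkin.of_functionAlgebra {ι : B →ₐ[ℂ] C(X, A)} (hB : IsDitkin B) [Nonempty X]
    (hconst : ContainsConstants X A B ι) (h : Continuous ι) : IsDitkin A := by
  intro φ a ha
  obtain ⟨x⟩ := ‹Nonempty X›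
  obtain ⟨f, hf⟩ := hconst a
  have hcl := hB (comapChar (evalHom ι x) (continuous_evalHom h x) φ) f (by
    change φ (ι f x) = 0
    rw [hf]
    exact ha)
  have hmem := map_mem_closure (continuous_evalHom h x) hcl
    (t := (fun u => a * u) '' Jid A φ) (by
      rintro _ ⟨u, hu, rfl⟩
      exact ⟨_, map_mem_Jid_s16 _ _ hu, by simp [hf]⟩)
  simpa [hf] using hmem

variable [CompactSpace X]

theorem IsUniform.continuous {ι : B →ₐ[ℂ] C(X, A)} (h : IsUniform X A B ι) : Continuous ι := by
  obtain ⟨c, C, hc, h⟩ := h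
  refine AddMonoidHomClass.continuous_of_bound ι c⁻¹ fun b => ?_
  rw [inv_mul_eq_div, le_div_iff₀' hc]
  exact (h b).1

theorem continuous_constHom {ι : B →ₐ[ℂ] C(X, A)} (hinj : Function.Injective ι)
    (hconst : ContainsConstants X A B ι) (hunif : IsUniform X A B ι) :
    Continuous (constHom hinj hconst) := by
  obtain ⟨c, C, hc, h⟩ := hunif
  refine AddMonoidHomClass.continuous_of_bound _ |C| fun a => (h _).2.trans ?_
  refine mul_le_mul (le_abs_self C) ?_ (norm_nonneg _) (abs_nonneg C)
  rw [ContinuousMap.norm_le _ (norm_nonneg a)]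
  intro x
  simp

/-- Bounded relative units force every character of `𝔄` to be an evaluation. -/
theorem HasBRU.exists_eq_evalChar {ι : B →ₐ[ℂ] C(X, A)} (hbru : HasBRU (scalarSub X A B ι))
    (hinj : Function.Injective ι) (h : Continuous ι) (φ : characterSpace ℂ A)
    (ψ : characterSpace ℂ (scalarSub X A B ι)) : ∃ x, evalChar h φ x = ψ := by
  by_contra hψ
  obtain ⟨M, -, hM⟩ := hbru ψ
  obtain ⟨b, hbJ, hb, -⟩ := hM _ (isCompact_range (continuous_evalChar h φ)) hψ
  have hb1 : b = 1 := by
    apply Subtype.ext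
    apply hinj
    ext x
    rw [← algebraMap_evalChar h φ, hb _ ⟨x, rfl⟩]
    simp
  have := apply_eq_zero_of_mem_Jid hbJ
  rw [hb1, map_one] at this
  exact one_ne_zero this

theorem IsDitkin.functionAlgebra (hA : IsDitkin A) (hss : IsSemisimple A)
    {ι : B →ₐ[ℂ] C(X, A)} (hinj : Function.Injective ι)
    (hconst : ContainsConstants X A B ι) (hadm : Admissible X A B ι)
    (hnat : ∀ τ : characterSpace ℂ B,
      ∃ (ψ : characterSpace ℂ (scalarSub X A B ι)) (φ : characterSpace ℂ A),
        ∀ (f : B) (g : scalarSub X A B ι),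
          (∀ x : X, ι (g : B) x = algebraMap ℂ A (φ (ι f x))) → τ f = ψ g)
    (hunif : IsUniform X A B ι) (hbru : HasBRU (scalarSub X A B ι)) : IsDitkin B := by
  have hι := hunif.continuous
  intro τ f hf
  obtain ⟨ψ, φ, hτ⟩ := hnat τ
  obtain ⟨x, rfl⟩ := hbru.exists_eq_evalChar hinj hι φ ψ
  have hτeval : ∀ b : B, τ b = φ (ι b x) := by
    intro b
    obtain ⟨g, hg⟩ := hadm b φ
    rw [hτ b ⟨g, fun z => ⟨_, hg z⟩⟩ hg, evalChar_apply]
    simp only [hg, AlgHomClass.commutes, Algebra.algebraMap_self_apply]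
  have hτconst : comapChar (constHom hinj hconst) (continuous_constHom hinj hconst hunif) τ = φ := by
    ext a
    change τ (constHom hinj hconst a) = φ a
    rw [hτeval, constHom_apply]
  have hτscalar : comapChar (scalarSub X A B ι).val continuous_subtype_val τ =
      evalChar hι φ x := by
    ext g
    exact hτeval g
  obtain ⟨M, hM0, hM⟩ := hbru (evalChar hι φ x)
  obtain ⟨c, C, hc, hnorm⟩ := hunif
  set D : ℝ := ‖(1 : A)‖ + M / c with hD
  have hD0 : 0 ≤ D := by positivity
  rw [Metric.mem_closure_iff]
  intro ε hε
  set η : ℝ := ε / (|C| * D + 1) with hη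
  have hη0 : 0 < η := by positivity
  have hfx : ι f x ∈ Iid A φ := by
    change φ (ι f x) = 0
    rw [← hτeval]
    exact hf
  obtain ⟨_, ⟨v, hv, rfl⟩, hvη⟩ := Metric.mem_closure_iff.1 (hA φ _ hfx) η hη0
  set k := constHom hinj hconst v with hk
  have hkJ : k ∈ Jid B τ := map_mem_Jid_s16 _ _ (hτconst.symm ▸ hv)
  set g : B := f - f * k with hg
  have hgx : ‖ι g x‖ < η := by
    simpa [hg, hk, dist_eq_norm] using hvη
  have hKcomp : IsCompact (evalChar hι φ '' {y | η ≤ ‖ι g y‖}) :=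
    (isClosed_le continuous_const (ι g).continuous.norm).isCompact.image
      (continuous_evalChar hι φ)
  obtain ⟨b, hbJ, hb1, hbM⟩ := hM _ hKcomp (by
    rintro ⟨y, hy, hyx⟩
    rw [Set.mem_ofPred_eq, apply_eq_of_evalChar_eq hss hadm hι φ hyx] at hy
    exact hgx.not_ge hy)
  have hbJ' : (b : B) ∈ Jid B τ := map_mem_Jid_s16 (scalarSub X A B ι).val
    continuous_subtype_val (hτscalar.symm ▸ hbJ)
  refine ⟨_, ⟨_, add_sub_mul_mem_Jid hkJ hbJ', rfl⟩, ?_⟩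
  have hfact : f - f * (k + b - k * b) = g * (1 - b) := by
    rw [hg]
    ring
  rw [dist_eq_norm, hfact]
  have hsup : ‖ι (g * (1 - b))‖ ≤ η * D := by
    rw [ContinuousMap.norm_le _ (by positivity)]
    intro y
    have hval : ι (g * (1 - b)) y = ι g y * (1 - ι (b : B) y) := by
      rw [map_mul ι g, map_sub ι 1, map_one]
      rfl
    rw [hval]
    by_cases hy : η ≤ ‖ι g y‖
    · have : ι (b : B) y = 1 := by
        rw [← algebraMap_evalChar hι φ, hb1 _ ⟨y, hy, rfl⟩, map_one]
      rw [this, sub_self, mul_zero, norm_zero]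
      positivity
    · refine (norm_mul_le _ _).trans ?_
      refine mul_le_mul (not_le.1 hy).le ?_ (norm_nonneg _) hη0.le
      refine (norm_sub_le _ _).trans (add_le_add le_rfl ?_)
      rw [le_div_iff₀' hc]
      calc c * ‖ι (b : B) y‖ ≤ c * ‖ι (b : B)‖ := by
            gcongr
            exact (ι (b : B)).norm_coe_le_norm y
        _ ≤ ‖(b : B)‖ := (hnorm _).1
        _ ≤ M := hbM
  calc ‖g * (1 - b)‖ ≤ C * ‖ι (g * (1 - b))‖ := (hnorm _).2
    _ ≤ |C| * (η * D) := mul_le_mul (le_abs_self C) hsup (norm_nonneg _) (abs_nonneg C)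
    _ = η * (|C| * D) := by ring
    _ < η * (|C| * D + 1) := by gcongr; linarith
    _ = ε := by rw [hη]; field_simp

end FunctionAlgebra

end VV

theorem ditkin_iff_of_uniform_bru
    (X : Type*) [TopologicalSpace X] [CompactSpace X] [T2Space X]
    (A : Type*) [NormedCommRing A] [NormedAlgebra ℂ A] [CompleteSpace A] [Nontrivial A]
    (hss : VV.IsSemisimple A)
    (B : Type*) [NormedCommRing B] [NormedAlgebra ℂ B] [CompleteSpace B] [Nontrivial B]
    (ι : B →ₐ[ℂ] C(X, A)) (hinj : Function.Injective ι)
    (hconst : VV.ContainsConstants X A B ι) (hsep : VV.Separates X A B ι)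
    (hadm : VV.Admissible X A B ι) (hnat : VV.NaturalProduct X A B ι)
    (hunif : VV.IsUniform X A B ι)
    (hbru : VV.HasBRU (VV.scalarSub X A B ι)) :
    VV.IsDitkin B ↔ VV.IsDitkin A := by
  have hι := hunif.continuous
  have : Nonempty X := by
    by_contra hX
    rw [not_nonempty_iff] at hX
    exact one_ne_zero (hinj (Subsingleton.elim (ι (1 : B)) (ι 0)))
  exact ⟨fun hB => hB.of_functionAlgebra hconst hι,
    fun hA => hA.functionAlgebra hss hinj hconst hadm hnat hunif hbru⟩
end
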